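/- With the same setup (Λ = A_{n,m}, indecomposable modules indexed by (0,t), 1 < t ≤ m/2): the set SE(t) := { i > 0 : Ext^i_Λ(X_t, X_t) ≠ 0 } satisfies SE(t−1) ⊆ SE(t); in particular the rigidity degree is monotone: rd(t) ≤ rd(t−1). -/

import Mathlib

open CategoryTheory CategoryTheory.Limits Opposite

universe u

namespace Rigidity

variable (Λ : Type u) [Ring Λ]

/-- `X` belongs to `add M`: it is a direct summand of a finite direct sum of copies of `M`. -/
def InAdd (M X : ModuleCat.{u} Λ) : Prop :=
  ∃ (r : ℕ) (Y : ModuleCat.{u} Λ), Nonempty ((X ⊞ Y) ≅ ⨁ (fun _ : Fin r => M))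

/-- An indecomposable object. -/
def Indec (X : ModuleCat.{u} Λ) : Prop :=
  ¬ IsZero X ∧ ∀ A B : ModuleCat.{u} Λ, Nonempty (X ≅ A ⊞ B) → IsZero A ∨ IsZero B

/-- A generator-cogenerator: `add M` contains the regular module and all
finitely generated injective modules. -/
def IsGenCogen (M : ModuleCat.{u} Λ) : Prop :=
  InAdd Λ M (ModuleCat.of Λ Λ) ∧
  ∀ I : ModuleCat.{u} Λ, Module.Finite Λ I → Injective I → InAdd Λ M I

/-- `g : A ⟶ X` is a right minimal `add M`-approximation. -/
def IsRMApprox (M : ModuleCat.{u} Λ) {A X : ModuleCat.{u} Λ} (g : A ⟶ X) : Prop :=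
  InAdd Λ M A ∧
  (∀ T : ModuleCat.{u} Λ, InAdd Λ M T → ∀ f : T ⟶ X, ∃ h : T ⟶ A, h ≫ g = f) ∧
  (∀ h : A ⟶ A, h ≫ g = g → IsIso h)

/-- `IsMSyzygy M X r W` : `W` is an `r`-th `M`-syzygy `Ω_M^r(X)` of `X`. -/
inductive IsMSyzygy (M : ModuleCat.{u} Λ) : ModuleCat.{u} Λ → ℕ → ModuleCat.{u} Λ → Prop
  | zero (X : ModuleCat.{u} Λ) : IsMSyzygy M X 0 X
  | succ (X : ModuleCat.{u} Λ) (r : ℕ) (W A : ModuleCat.{u} Λ) (g : A ⟶ W)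
      (hW : IsMSyzygy M X r W) (hg : IsRMApprox Λ M g) :
      IsMSyzygy M X (r + 1) (kernel g)

/-- The `M`-dimension of `X` is at most `r`. -/
def MdimLE (M X : ModuleCat.{u} Λ) (r : ℕ) : Prop :=
  ∃ W : ModuleCat.{u} Λ, IsMSyzygy Λ M X r W ∧ InAdd Λ M W

/-- projective dimension at most `r`, via a length `r` projective resolution. -/
def ProjDimLE (A : Type u) [Ring A] (N : ModuleCat.{u} A) (r : ℕ) : Prop :=
  ∃ (P : ℕ → ModuleCat.{u} A) (d : ∀ i : ℕ, P (i + 1) ⟶ P i) (f : P 0 ⟶ N),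
    (∀ i, Projective (P i)) ∧ (∀ i, r < i → IsZero (P i)) ∧ Epi f ∧
    (∃ w : d 0 ≫ f = 0, (ShortComplex.mk (d 0) f w).Exact) ∧
    (∀ i, ∃ w : d (i + 1) ≫ d i = 0, (ShortComplex.mk (d (i + 1)) (d i) w).Exact)

/-- global dimension at most `r`. -/
def GldimLE (A : Type u) [Ring A] (r : ℕ) : Prop :=
  ∀ N : ModuleCat.{u} A, ProjDimLE A N r

/-- the global dimension, as an element of `ℕ∞`. -/
noncomputable def gldim (A : Type u) [Ring A] : ℕ∞ :=
  sInf {c : ℕ∞ | ∃ r : ℕ, c = (r : ℕ∞) ∧ GldimLE A r}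

/-- dominant dimension at least `r`: there is an exact sequence
`0 → A → I^0 → ⋯ → I^(r-1)` with all `I^i` projective-injective. -/
def DomdimGE (A : Type u) [Ring A] (r : ℕ) : Prop :=
  ∃ (I : ℕ → ModuleCat.{u} A) (f : ModuleCat.of A A ⟶ I 0) (g : ∀ i : ℕ, I i ⟶ I (i + 1)),
    Mono f ∧ (∀ i, i < r → Injective (I i) ∧ Projective (I i)) ∧
    (2 ≤ r → ∃ w : f ≫ g 0 = 0, (ShortComplex.mk f (g 0) w).Exact) ∧
    (∀ i, i + 3 ≤ r → ∃ w : g i ≫ g (i + 1) = 0, (ShortComplex.mk (g i) (g (i + 1)) w).Exact)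

/-- the dominant dimension, as an element of `ℕ∞`. -/
noncomputable def domdim (A : Type u) [Ring A] : ℕ∞ :=
  sSup {c : ℕ∞ | ∃ r : ℕ, c = (r : ℕ∞) ∧ DomdimGE A r}

/-- the rigidity degree of a module, as an element of `ℕ∞`. -/
noncomputable def rigDeg [HasExt.{u} (ModuleCat.{u} Λ)] (M : ModuleCat.{u} Λ) : ℕ∞ :=
  sSup {c : ℕ∞ | ∃ r : ℕ, c = (r : ℕ∞) ∧ 0 < r ∧
    ∀ i : ℕ, 1 ≤ i → i ≤ r → Subsingleton (Abelian.Ext M M i)}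

/-- the rigidity dimension. -/
noncomputable def rigdim : ℕ∞ :=
  sSup {c : ℕ∞ | ∃ M : ModuleCat.{u} Λ, Module.Finite Λ M ∧ IsGenCogen Λ M ∧
    (∃ r : ℕ, GldimLE (End (op M)) r) ∧ c = domdim (End (op M))}

/-- An Auslander-Reiten (almost split) sequence. -/
def IsARSeq {X Y Z : ModuleCat.{u} Λ} (f : X ⟶ Y) (g : Y ⟶ Z) : Prop :=
  Mono f ∧ Epi g ∧ (∃ w : f ≫ g = 0, (ShortComplex.mk f g w).Exact) ∧
  Indec Λ X ∧ Indec Λ Z ∧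
  (¬ ∃ s : Z ⟶ Y, s ≫ g = 𝟙 Z) ∧
  (∀ (W : ModuleCat.{u} Λ) (h : W ⟶ Z), (¬ ∃ s : Z ⟶ W, s ≫ h = 𝟙 Z) →
    ∃ h' : W ⟶ Y, h' ≫ g = h)

/-- `X` has composition length `t`. -/
def HasCompLength (X : ModuleCat.{u} Λ) (t : ℕ) : Prop :=
  (∃ c : Fin (t + 1) → Submodule Λ X, StrictMono c ∧ c 0 = ⊥ ∧ c (Fin.last t) = ⊤) ∧
  ∀ r : ℕ, (∃ c : Fin (r + 1) → Submodule Λ X, StrictMono c ∧ c 0 = ⊥ ∧ c (Fin.last r) = ⊤) →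
    r ≤ t


/-- powers of the Jacobson radical, as left submodules of `Λ`. -/
def radPow (Λ : Type u) [Ring Λ] : ℕ → Submodule Λ Λ
  | 0 => ⊤
  | r + 1 => Submodule.span Λ
      {x : Λ | ∃ a ∈ Ideal.jacobson (⊥ : Ideal Λ), ∃ b ∈ radPow Λ r, x = a * b}

/-- `Λ` is the connected self-injective Nakayama algebra over `k`
with `n` simple modules and Loewy length `m`. -/
structure IsSelfInjNakayama (k : Type u) (Λ : Type u) [Field k] [Ring Λ] [Algebra k Λ]
    (n m : ℕ) : Prop where
  findim : FiniteDimensional k Λ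
  connected : ∀ e : Λ, IsIdempotentElem e → e ∈ Set.center Λ → e = 0 ∨ e = 1
  selfinj : Injective (ModuleCat.of Λ Λ)
  uniserial : ∀ X : ModuleCat.{u} Λ, Module.Finite Λ X → Indec Λ X →
    ∀ N₁ N₂ : Submodule Λ X, N₁ ≤ N₂ ∨ N₂ ≤ N₁
  simples : ∃ S : Fin n → ModuleCat.{u} Λ, (∀ i, IsSimpleModule Λ (S i)) ∧
    (∀ i j, Nonempty (S i ≅ S j) → i = j) ∧
    ∀ T : ModuleCat.{u} Λ, IsSimpleModule Λ T → ∃ i, Nonempty (T ≅ S i)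
  loewy_top : radPow Λ m = ⊥
  loewy_bot : radPow Λ (m - 1) ≠ ⊥

section RadicalLayers

variable {R : Type u} [Ring R]

/-- The submodules of `M` form a chain. -/
def Uniserial (R : Type u) [Ring R] (M : Type u) [AddCommGroup M] [Module R M] : Prop :=
  ∀ N₁ N₂ : Submodule R M, N₁ ≤ N₂ ∨ N₂ ≤ N₁

/-- The submodule `J ^ a N`, where `J` is the Jacobson radical. -/
def radLayer {M : Type u} [AddCommGroup M] [Module R M] (N : Submodule R M) : ℕ → Submodule R M
  | 0 => N
  | a + 1 => Ring.jacobson R • radLayer N a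

/-- `a` is the Loewy length of the submodule `N`. -/
def HasLoewyLength {M : Type u} [AddCommGroup M] [Module R M] (N : Submodule R M) (a : ℕ) : Prop :=
  ∀ b : ℕ, radLayer N b = ⊥ ↔ a ≤ b

variable {M : Type u} [AddCommGroup M] [Module R M]
variable {M' : Type u} [AddCommGroup M'] [Module R M']

theorem Uniserial.submodule (h : Uniserial R M) (N : Submodule R M) : Uniserial R N := by
  intro N₁ N₂
  have hinj : Function.Injective N.subtype := N.injective_subtype
  simpa [Submodule.map_le_map_iff_of_injective hinj] using h (N₁.map N.subtype) (N₂.map N.subtype)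

theorem Uniserial.of_surjective (h : Uniserial R M) (f : M →ₗ[R] M')
    (hf : Function.Surjective f) : Uniserial R M' := by
  intro N₁ N₂
  simpa [Submodule.comap_le_comap_iff_of_surjective hf] using h (N₁.comap f) (N₂.comap f)

theorem smul_le_self (I : Ideal R) (N : Submodule R M) : I • N ≤ N :=
  Submodule.smul_le.2 fun r _ _ hx => N.smul_mem r hx

theorem radLayer_radLayer (N : Submodule R M) (a b : ℕ) :
    radLayer (radLayer N b) a = radLayer N (a + b) := by
  induction a with
  | zero => rw [zero_add]; rfl
  | succ a ih => rw [Nat.succ_add]; exact congrArg _ ih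

theorem radLayer_smul (N : Submodule R M) (a : ℕ) :
    radLayer (Ring.jacobson R • N) a = radLayer N (a + 1) :=
  radLayer_radLayer N a 1

theorem map_radLayer (f : M →ₗ[R] M') (N : Submodule R M) (a : ℕ) :
    (radLayer N a).map f = radLayer (N.map f) a := by
  induction a with
  | zero => rfl
  | succ a ih => rw [radLayer, radLayer, Submodule.map_smul'', ih]

theorem radLayer_mono {N N' : Submodule R M} (h : N ≤ N') (a : ℕ) :
    radLayer N a ≤ radLayer N' a := by
  induction a with
  | zero => exact h
  | succ a ih => exact Submodule.smul_mono le_rfl ih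

theorem radLayer_antitone (N : Submodule R M) : Antitone (radLayer N) :=
  antitone_nat_of_succ_le fun _ => smul_le_self _ _

theorem radLayer_top_eq_bot_iff (N : Submodule R M) (b : ℕ) :
    radLayer (⊤ : Submodule R N) b = ⊥ ↔ radLayer N b = ⊥ := by
  rw [← (Submodule.map_injective_of_injective N.injective_subtype).eq_iff, map_radLayer,
    Submodule.map_top, Submodule.range_subtype, Submodule.map_bot]

theorem HasLoewyLength.top_iff {N : Submodule R M} {a : ℕ} :
    HasLoewyLength (⊤ : Submodule R N) a ↔ HasLoewyLength N a := by
  simp [HasLoewyLength, radLayer_top_eq_bot_iff]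

theorem HasLoewyLength.eq {N : Submodule R M} {a b : ℕ} (ha : HasLoewyLength N a)
    (hb : HasLoewyLength N b) : a = b :=
  le_antisymm ((ha b).1 ((hb b).2 le_rfl)) ((hb a).1 ((ha a).2 le_rfl))

theorem HasLoewyLength.radLayer {N : Submodule R M} {a : ℕ} (ha : HasLoewyLength N a) (b : ℕ) :
    HasLoewyLength (radLayer N b) (a - b) := by
  intro c
  rw [radLayer_radLayer, ha]
  omega

theorem eq_bot_of_le_smul [IsArtinianRing R] [Module.Finite R M] {N : Submodule R M}
    (h : N ≤ Ring.jacobson R • N) : N = ⊥ :=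
  Submodule.FG.eq_bot_of_le_jacobson_smul (IsNoetherian.noetherian N) h

theorem exists_hasLoewyLength [IsArtinianRing R] [Module.Finite R M] (N : Submodule R M) :
    ∃ a, HasLoewyLength N a := by
  classical
  have hex : ∃ a, radLayer N a = ⊥ := by
    obtain ⟨a, ha⟩ := IsArtinian.monotone_stabilizes
      ⟨fun a => OrderDual.toDual (radLayer N a), fun _ _ h => radLayer_antitone N h⟩
    have h : radLayer N a = radLayer N (a + 1) := ha (a + 1) (Nat.le_succ a)
    exact ⟨a, eq_bot_of_le_smul h.le⟩
  refine ⟨Nat.find hex, fun b => ⟨fun h => Nat.find_min' hex h, fun h => ?_⟩⟩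
  exact le_bot_iff.1 ((radLayer_antitone N h).trans (Nat.find_spec hex).le)

/-- A proper submodule of a uniserial module is contained in its radical. -/
theorem Uniserial.le_smul_top_or_eq_top [IsArtinianRing R] (h : Uniserial R M)
    (N : Submodule R M) : N ≤ Ring.jacobson R • (⊤ : Submodule R M) ∨ N = ⊤ := by
  set L : Submodule R M := Ring.jacobson R • (⊤ : Submodule R M)
  have hss : IsSemisimpleModule R (M ⧸ L) := by
    have ht : Module.IsTorsionBySet R (M ⧸ L) (Ring.jacobson R : Set R) := by
      rintro x ⟨r, hr⟩
      obtain ⟨y, rfl⟩ := L.mkQ_surjective x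
      change r • L.mkQ y = 0
      rw [← map_smul, Submodule.mkQ_apply, Submodule.Quotient.mk_eq_zero]
      exact Submodule.smul_mem_smul hr Submodule.mem_top
    let := ht.module
    exact ht.isSemisimpleModule_iff.1 inferInstance
  have huni : Uniserial R (M ⧸ L) := h.of_surjective L.mkQ L.mkQ_surjective
  obtain ⟨C, hC⟩ := exists_isCompl (N.map L.mkQ)
  rcases huni (N.map L.mkQ) C with hle | hle
  · left
    have hbot : N.map L.mkQ = ⊥ := by
      have := hC.inf_eq_bot
      rwa [inf_eq_left.2 hle] at this
    rw [← LinearMap.le_ker_iff_map, Submodule.ker_mkQ] at hbot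
    exact hbot
  · rcases h N L with hNL | hLN
    · exact Or.inl hNL
    · right
      have htop : N.map L.mkQ = ⊤ := by
        have := hC.sup_eq_top
        rwa [sup_eq_left.2 hle] at this
      have := congrArg (Submodule.comap L.mkQ) htop
      rwa [Submodule.comap_map_mkQ, sup_eq_right.2 hLN, Submodule.comap_top] at this

theorem Uniserial.le_smul_or_eq [IsArtinianRing R] (h : Uniserial R M)
    {N L : Submodule R M} (hNL : N ≤ L) : N ≤ Ring.jacobson R • L ∨ N = L := by
  have hmap : (N.submoduleOf L).map L.subtype = N := by
    rw [Submodule.submoduleOf, Submodule.map_comap_subtype, inf_eq_right.2 hNL]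
  rcases (h.submodule L).le_smul_top_or_eq_top (N.submoduleOf L) with hN | hN
  · left
    have := Submodule.map_mono (f := L.subtype) hN
    rwa [hmap, Submodule.map_smul'', Submodule.map_top, Submodule.range_subtype] at this
  · right
    rw [← hmap, hN, Submodule.map_top, Submodule.range_subtype]

/-- Every submodule of a uniserial module is a radical layer. -/
theorem Uniserial.exists_eq_radLayer [IsArtinianRing R] [Module.Finite R M] (h : Uniserial R M)
    (N : Submodule R M) : ∃ j, N = radLayer (⊤ : Submodule R M) j := by
  classical
  by_cases hex : ∃ j, ¬ N ≤ radLayer (⊤ : Submodule R M) j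
  · obtain ⟨j, hj⟩ : ∃ j, Nat.find hex = j + 1 := by
      refine Nat.exists_eq_succ_of_ne_zero fun h0 => ?_
      have := Nat.find_spec hex
      rw [h0] at this
      exact this le_top
    have hle : N ≤ radLayer (⊤ : Submodule R M) j :=
      not_not.1 (Nat.find_min hex (by omega))
    refine ⟨j, (h.le_smul_or_eq hle).resolve_left ?_⟩
    change ¬ N ≤ radLayer ⊤ (j + 1)
    rw [← hj]
    exact Nat.find_spec hex
  · push Not at hex
    obtain ⟨a, ha⟩ := exists_hasLoewyLength (⊤ : Submodule R M)
    refine ⟨a, le_antisymm (hex a) ?_⟩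
    rw [(ha a).2 le_rfl]
    exact bot_le

/-- The kernel of a map out of a uniserial module is the radical layer determined by the
Loewy length of its range. -/
theorem Uniserial.ker_eq [IsArtinianRing R] [Module.Finite R M] (h : Uniserial R M)
    (f : M →ₗ[R] M') {a : ℕ}
    (ha : HasLoewyLength (LinearMap.range f) a) :
    LinearMap.ker f = radLayer (⊤ : Submodule R M) a := by
  have key (b : ℕ) : radLayer (⊤ : Submodule R M) b ≤ LinearMap.ker f ↔ a ≤ b := by
    rw [← ha b, ← Submodule.map_top, ← map_radLayer, LinearMap.le_ker_iff_map]
  obtain ⟨j, hj⟩ := h.exists_eq_radLayer (LinearMap.ker f)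
  refine le_antisymm ?_ ((key a).2 le_rfl)
  rw [hj]
  exact radLayer_antitone _ ((key j).1 hj.ge)

end RadicalLayers

section CoverSystems

variable {R : Type u} [Ring R]

/-- A family of uniserial projective-injective modules which contains exactly one projective
cover of each simple module. -/
structure IsCoverSystem {ι : Type} (P : ι → ModuleCat.{u} R) : Prop where
  finite (i : ι) : Module.Finite R (P i)
  projective (i : ι) : Module.Projective R (P i)
  injective (i : ι) : Module.Injective R (P i)
  uniserial (i : ι) : Uniserial R (P i)
  exists_surjective (T : Type u) [AddCommGroup T] [Module R T] [IsSimpleModule R T] :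
    ∃ (i : ι) (f : P i →ₗ[R] T), Function.Surjective f
  eq_of_surjective (T : Type u) [AddCommGroup T] [Module R T] [IsSimpleModule R T] (i j : ι)
    (f : P i →ₗ[R] T) (g : P j →ₗ[R] T) :
    Function.Surjective f → Function.Surjective g → i = j

/-- The submodule `N` is a nonzero quotient of `P i`. -/
def Covers {ι : Type} (P : ι → ModuleCat.{u} R) (i : ι) {M : Type u} [AddCommGroup M]
    [Module R M] (N : Submodule R M) : Prop :=
  N ≠ ⊥ ∧ ∃ f : P i →ₗ[R] M, LinearMap.range f = N

variable {ι : Type} {P : ι → ModuleCat.{u} R}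
variable {M : Type u} [AddCommGroup M] [Module R M]
variable {M' : Type u} [AddCommGroup M'] [Module R M']

theorem Covers.map {i : ι} {N : Submodule R M} (h : Covers P i N) (f : M →ₗ[R] M')
    (hf : N.map f ≠ ⊥) : Covers P i (N.map f) := by
  obtain ⟨-, g, rfl⟩ := h
  exact ⟨hf, f ∘ₗ g, LinearMap.range_comp g f⟩

theorem Covers.top_iff {i : ι} {N : Submodule R M} :
    Covers P i (⊤ : Submodule R N) ↔ Covers P i N := by
  constructor
  · intro h
    have hmap : (⊤ : Submodule R N).map N.subtype = N := by simp
    have hne : (⊤ : Submodule R N).map N.subtype ≠ ⊥ := by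
      rw [Ne, ← Submodule.map_bot N.subtype,
        (Submodule.map_injective_of_injective N.injective_subtype).eq_iff]
      exact h.1
    have := h.map N.subtype hne
    rwa [hmap] at this
  · rintro ⟨hN, f, rfl⟩
    refine ⟨?_, f.rangeRestrict, LinearMap.range_rangeRestrict f⟩
    intro h
    apply hN
    have := congrArg (Submodule.map (LinearMap.range f).subtype) h
    simpa using this

namespace IsCoverSystem

theorem factor_of_ker_le (hP : IsCoverSystem P) {i : ι} (f : M →ₗ[R] M') (g : M →ₗ[R] P i)
    (h : LinearMap.ker f ≤ LinearMap.ker g) : ∃ k : M' →ₗ[R] P i, k ∘ₗ f = g := by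
  obtain ⟨k, hk⟩ := (hP.injective i).out ((LinearMap.ker f).liftQ f le_rfl)
    (LinearMap.ker_eq_bot.1 (Submodule.ker_liftQ_eq_bot _ _ _ le_rfl))
    ((LinearMap.ker f).liftQ g h)
  refine ⟨k, LinearMap.ext fun x => ?_⟩
  simpa using hk ((LinearMap.ker f).mkQ x)

theorem covers_unique (hP : IsCoverSystem P) {i j : ι} {N : Submodule R M}
    (hi : Covers P i N) (hj : Covers P j N) : i = j := by
  rw [← Covers.top_iff] at hi hj
  obtain ⟨hN, f, hf⟩ := hi
  obtain ⟨-, g, hg⟩ := hj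
  rw [LinearMap.range_eq_top] at hf hg
  have := hP.finite i
  have : Module.Finite R N := Module.Finite.of_surjective f hf
  obtain ⟨C, hC, -⟩ := (eq_top_or_exists_le_coatom (⊥ : Submodule R N)).resolve_left hN.symm
  have : IsSimpleModule R (N ⧸ C) := isSimpleModule_iff_isCoatom.2 hC
  exact hP.eq_of_surjective (N ⧸ C) i j (C.mkQ ∘ₗ f) (C.mkQ ∘ₗ g)
    (C.mkQ_surjective.comp hf) (C.mkQ_surjective.comp hg)

theorem exists_map_to_quotient (hP : IsCoverSystem P) {C : Submodule R M} (hC : IsCoatom C) :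
    ∃ (i : ι) (f : P i →ₗ[R] M), ¬ LinearMap.range f ≤ C := by
  have : IsSimpleModule R (M ⧸ C) := isSimpleModule_iff_isCoatom.2 hC
  obtain ⟨i, f, hf⟩ := hP.exists_surjective (M ⧸ C)
  have := hP.projective i
  obtain ⟨g, hg⟩ := Module.projective_lifting_property C.mkQ f C.mkQ_surjective
  refine ⟨i, g, fun hle => ?_⟩
  have hf0 : f = 0 := by
    rw [← hg]
    ext x
    simpa using hle (LinearMap.mem_range_self g x)
  have := IsSimpleModule.nontrivial R (M ⧸ C)
  obtain ⟨y, hy⟩ := exists_ne (0 : M ⧸ C)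
  obtain ⟨x, rfl⟩ := hf y
  exact hy (by rw [hf0]; rfl)

theorem iSup_range_eq_top (hP : IsCoverSystem P) [Module.Finite R M] :
    (⨆ (i : ι) (f : P i →ₗ[R] M), LinearMap.range f) = ⊤ := by
  by_contra hne
  obtain ⟨C, hC, hle⟩ := (eq_top_or_exists_le_coatom _).resolve_left hne
  obtain ⟨i, f, hf⟩ := hP.exists_map_to_quotient hC
  exact hf ((le_iSup₂_of_le i f le_rfl).trans hle)

theorem eq_zero_of_smul_eq_zero (hP : IsCoverSystem P) {x : R}
    (h : ∀ (i : ι) (p : P i), x • p = 0) : x = 0 := by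
  have key : (⊤ : Submodule R R) ≤ Submodule.span R {y : R | ∀ r, x * (r * y) = 0} := by
    rw [← hP.iSup_range_eq_top (M := R)]
    refine iSup₂_le fun i f => ?_
    rintro _ ⟨p, rfl⟩
    refine Submodule.subset_span fun r => ?_
    rw [← smul_eq_mul, ← smul_eq_mul, ← map_smul, ← map_smul, h, map_zero]
  have hspan : ∀ r : R, x * (r * 1) = 0 := by
    refine Submodule.span_induction (p := fun y _ => ∀ r, x * (r * y) = 0) (fun y hy => hy)
      (by simp) ?_ ?_ (key (Submodule.mem_top (x := (1 : R))))
    · intro y z _ _ hy hz r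
      rw [mul_add, mul_add, hy, hz, add_zero]
    · intro a y _ hy r
      rw [smul_eq_mul, ← mul_assoc r]
      exact hy _
  simpa using hspan 1

theorem exists_covers_top [IsArtinianRing R] (hP : IsCoverSystem P) [Module.Finite R M]
    (h : Uniserial R M) (hM : (⊤ : Submodule R M) ≠ ⊥) : ∃ i, Covers P i (⊤ : Submodule R M) := by
  obtain ⟨C, hC, -⟩ := (eq_top_or_exists_le_coatom (⊥ : Submodule R M)).resolve_left hM.symm
  obtain ⟨i, f, hf⟩ := hP.exists_map_to_quotient hC
  refine ⟨i, hM, f, (h.le_smul_top_or_eq_top _).resolve_left fun hle => ?_⟩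
  rcases h.le_smul_top_or_eq_top C with hC' | hC'
  · have : C = Ring.jacobson R • (⊤ : Submodule R M) := by
      refine hC'.eq_or_lt.resolve_right fun hlt => hM (eq_bot_of_le_smul ?_)
      exact (hC.2 _ hlt).ge
    exact hf (this ▸ hle)
  · exact hC.1 hC'

theorem exists_covers [IsArtinianRing R] (hP : IsCoverSystem P) [Module.Finite R M]
    (h : Uniserial R M) {N : Submodule R M} (hN : N ≠ ⊥) : ∃ i, Covers P i N := by
  have : Module.Finite R N := Module.Finite.of_fg (IsNoetherian.noetherian N)
  obtain ⟨i, hi⟩ := hP.exists_covers_top (h.submodule N) fun h => hN <| by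
    simpa using congrArg (Submodule.map N.subtype) h
  exact ⟨i, Covers.top_iff.1 hi⟩

open Classical in
/-- The index of the projective cover of the radical of `P i`. -/
noncomputable def next (_ : IsCoverSystem P) (i : ι) : ι :=
  if h : ∃ j, Covers P j (Ring.jacobson R • (⊤ : Submodule R (P i))) then h.choose else i

theorem covers_next [IsArtinianRing R] (hP : IsCoverSystem P) {i : ι}
    (h : Ring.jacobson R • (⊤ : Submodule R (P i)) ≠ ⊥) :
    Covers P (hP.next i) (Ring.jacobson R • (⊤ : Submodule R (P i))) := by
  have := hP.finite i
  have hex := hP.exists_covers (hP.uniserial i) h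
  rw [next, dif_pos hex]
  exact hex.choose_spec

theorem next_eq_self (hP : IsCoverSystem P) {i : ι}
    (h : Ring.jacobson R • (⊤ : Submodule R (P i)) = ⊥) : hP.next i = i :=
  dif_neg fun ⟨_, hj⟩ => hj.1 h

variable [IsArtinianRing R]

theorem covers_smul (hP : IsCoverSystem P) {i : ι} {N : Submodule R M} (h : Covers P i N)
    (hN : Ring.jacobson R • N ≠ ⊥) : Covers P (hP.next i) (Ring.jacobson R • N) := by
  obtain ⟨-, f, rfl⟩ := h
  have hmap : (Ring.jacobson R • (⊤ : Submodule R (P i))).map f =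
      Ring.jacobson R • LinearMap.range f := by
    rw [Submodule.map_smul'', Submodule.map_top]
  rw [← hmap] at hN ⊢
  exact (hP.covers_next fun h0 => hN (by rw [h0, Submodule.map_bot])).map f hN

theorem covers_radLayer (hP : IsCoverSystem P) {i : ι} {N : Submodule R M} (h : Covers P i N)
    (a : ℕ) (hN : radLayer N a ≠ ⊥) : Covers P (hP.next^[a] i) (radLayer N a) := by
  induction a with
  | zero => exact h
  | succ a ih =>
    rw [Function.iterate_succ_apply']
    refine hP.covers_smul (ih fun h0 => hN ?_) hN
    rw [radLayer, h0, Submodule.smul_bot]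

/-- The projective cover of the radical of `P i` is not injective. -/
theorem ker_ne_bot (hP : IsCoverSystem P) {i j : ι}
    (h : Ring.jacobson R • (⊤ : Submodule R (P i)) ≠ ⊥) (f : P j →ₗ[R] P i)
    (hf : LinearMap.range f = Ring.jacobson R • (⊤ : Submodule R (P i))) :
    LinearMap.ker f ≠ ⊥ := by
  intro hker
  have := hP.finite i
  obtain ⟨r, hr⟩ := hP.factor_of_ker_le f LinearMap.id (hker.le.trans bot_le)
  have hinf : LinearMap.ker r ⊓ LinearMap.range f = ⊥ := by
    rw [eq_bot_iff]
    rintro _ ⟨hx, y, rfl⟩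
    have h1 : r (f y) = y := LinearMap.congr_fun hr y
    have h2 : r (f y) = 0 := hx
    rw [Submodule.mem_bot, ← h1, h2, map_zero]
  rw [hf] at hinf
  rcases (hP.uniserial i).le_smul_top_or_eq_top (LinearMap.ker r) with hle | htop
  · rw [inf_eq_left.2 hle] at hinf
    have htop : LinearMap.range f = ⊤ := by
      rw [LinearMap.range_eq_top]
      intro x
      refine ⟨r x, LinearMap.ker_eq_bot.1 hinf ?_⟩
      exact LinearMap.congr_fun hr (r x)
    rw [htop] at hf
    apply h
    rw [← hf]
    exact eq_bot_of_le_smul hf.le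
  · rw [htop, top_inf_eq] at hinf
    exact h hinf

theorem next_injective (hP : IsCoverSystem P) : Function.Injective hP.next := by
  have key : ∀ {i j : ι}, Ring.jacobson R • (⊤ : Submodule R (P i)) ≠ ⊥ →
      hP.next i = j → Ring.jacobson R • (⊤ : Submodule R (P j)) ≠ ⊥ := by
    intro i j hi hij hj
    have hc := hP.covers_next hi
    rw [hij] at hc
    obtain ⟨-, f, hf⟩ := hc
    rcases (hP.uniserial j).le_smul_top_or_eq_top (LinearMap.ker f) with hle | htop
    · exact hP.ker_ne_bot hi f hf (le_bot_iff.1 (hj ▸ hle))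
    · rw [LinearMap.ker_eq_top.1 htop, LinearMap.range_zero] at hf
      exact hi hf.symm
  have main : ∀ {i j k : ι} (f : P k →ₗ[R] P i) (g : P k →ₗ[R] P j),
      Ring.jacobson R • (⊤ : Submodule R (P i)) ≠ ⊥ →
      LinearMap.range f = Ring.jacobson R • (⊤ : Submodule R (P i)) →
      LinearMap.range g = Ring.jacobson R • (⊤ : Submodule R (P j)) →
      LinearMap.ker g ≤ LinearMap.ker f → i = j := by
    intro i j k f g hi hf hg hle
    have := hP.finite i
    obtain ⟨h, hh⟩ := hP.factor_of_ker_le g f hle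
    have hrange : Ring.jacobson R • (⊤ : Submodule R (P i)) =
        Ring.jacobson R • LinearMap.range h := by
      rw [← hf, ← hh, LinearMap.range_comp, hg, Submodule.map_smul'', Submodule.map_top]
    have hne : (⊤ : Submodule R (P i)) ≠ ⊥ := fun h0 => hi (by rw [h0, Submodule.smul_bot])
    rcases (hP.uniserial i).le_smul_top_or_eq_top (LinearMap.range h) with hle' | htop
    · exact absurd (eq_bot_of_le_smul (hrange.le.trans (Submodule.smul_mono le_rfl hle'))) hi
    · exact hP.covers_unique ⟨hne, LinearMap.id, LinearMap.range_id⟩ ⟨hne, h, htop⟩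
  intro i j hij
  by_cases hi : Ring.jacobson R • (⊤ : Submodule R (P i)) = ⊥
  · by_cases hj : Ring.jacobson R • (⊤ : Submodule R (P j)) = ⊥
    · rw [← hP.next_eq_self hi, hij, hP.next_eq_self hj]
    · exact absurd hi (key hj (hij.symm.trans (hP.next_eq_self hi)))
  · by_cases hj : Ring.jacobson R • (⊤ : Submodule R (P j)) = ⊥
    · exact absurd hj (key hi (hij.trans (hP.next_eq_self hj)))
    · obtain ⟨-, f, hf⟩ := hP.covers_next hi
      have hc := hP.covers_next hj
      rw [← hij] at hc
      obtain ⟨-, g, hg⟩ := hc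
      rcases hP.uniserial _ (LinearMap.ker g) (LinearMap.ker f) with hle | hle
      · exact main f g hi hf hg hle
      · exact (main g f hj hg hf hle).symm

theorem loewyLength_le_next (hP : IsCoverSystem P) {i : ι} {a b : ℕ}
    (ha : HasLoewyLength (⊤ : Submodule R (P i)) a)
    (hb : HasLoewyLength (⊤ : Submodule R (P (hP.next i))) b) : a ≤ b := by
  by_cases hi : Ring.jacobson R • (⊤ : Submodule R (P i)) = ⊥
  · rw [hP.next_eq_self hi] at hb
    exact (ha.eq hb).le
  · obtain ⟨-, f, hf⟩ := hP.covers_next hi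
    have := hP.finite (hP.next i)
    have hker := hP.ker_ne_bot hi f hf
    obtain ⟨e, he⟩ := (hP.uniserial _).exists_eq_radLayer (LinearMap.ker f)
    rw [he, Ne, hb, not_le] at hker
    obtain ⟨b, rfl⟩ : ∃ b', b = b' + 1 := ⟨b - 1, by omega⟩
    have h0 : (radLayer ⊤ b).map f = ⊥ := by
      rw [← LinearMap.le_ker_iff_map, he]
      exact radLayer_antitone _ (by omega)
    rw [map_radLayer, Submodule.map_top, hf, radLayer_smul, ha] at h0
    exact h0

/-- In a connected ring, no proper nonempty set of indices is stable under `next`. -/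
theorem eq_empty_or_univ (hP : IsCoverSystem P) (hne : ∀ i, (⊤ : Submodule R (P i)) ≠ ⊥)
    (hR : ∀ e : R, IsIdempotentElem e → e ∈ Set.center R → e = 0 ∨ e = 1)
    (O : Set ι) (hO : ∀ i, hP.next i ∈ O ↔ i ∈ O) : O = ∅ ∨ O = Set.univ := by
  have hiter (a : ℕ) (i : ι) : hP.next^[a] i ∈ O ↔ i ∈ O := by
    induction a with
    | zero => rfl
    | succ a ih => rw [Function.iterate_succ_apply', hO, ih]
  have hom_zero {i j : ι} (hij : ¬ (i ∈ O ↔ j ∈ O)) (f : P i →ₗ[R] P j) : f = 0 := by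
    by_contra hf
    have := hP.finite j
    have hr : LinearMap.range f ≠ ⊥ := fun h => hf (LinearMap.range_eq_bot.1 h)
    obtain ⟨a, ha⟩ := (hP.uniserial j).exists_eq_radLayer (LinearMap.range f)
    have hi : Covers P i (LinearMap.range f) := ⟨hr, f, rfl⟩
    have hj : Covers P (hP.next^[a] j) (LinearMap.range f) := by
      rw [ha] at hr ⊢
      exact hP.covers_radLayer ⟨hne j, LinearMap.id, LinearMap.range_id⟩ a hr
    rw [hP.covers_unique hi hj, hiter] at hij
    exact hij Iff.rfl
  let A : Submodule R R := ⨅ (i : ι) (_ : i ∉ O), Module.annihilator R (P i)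
  let B : Submodule R R := ⨅ (i : ι) (_ : i ∈ O), Module.annihilator R (P i)
  have memA {x : R} : x ∈ A ↔ ∀ i, i ∉ O → ∀ p : P i, x • p = 0 := by
    simp [A, Submodule.mem_iInf, Module.mem_annihilator]
  have memB {x : R} : x ∈ B ↔ ∀ i, i ∈ O → ∀ p : P i, x • p = 0 := by
    simp [B, Submodule.mem_iInf, Module.mem_annihilator]
  have hAB : A ⊔ B = ⊤ := by
    rw [eq_top_iff, ← hP.iSup_range_eq_top (M := R)]
    refine iSup₂_le fun i f => ?_
    have hz {j : ι} (hij : ¬ (i ∈ O ↔ j ∈ O)) (p : P i) (q : P j) : f p • q = 0 :=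
      LinearMap.congr_fun (hom_zero hij (LinearMap.toSpanSingleton R (P j) q ∘ₗ f)) p
    by_cases hi : i ∈ O
    · refine le_trans ?_ le_sup_left
      rintro _ ⟨p, rfl⟩
      exact memA.2 fun j hj q => hz (by tauto) p q
    · refine le_trans ?_ le_sup_right
      rintro _ ⟨p, rfl⟩
      exact memB.2 fun j hj q => hz (by tauto) p q
  have hzero {x : R} (hA : x ∈ A) (hB : x ∈ B) : x = 0 :=
    hP.eq_zero_of_smul_eq_zero fun i p => by
      by_cases hi : i ∈ O
      · exact memB.1 hB i hi p
      · exact memA.1 hA i hi p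
  have hA_mul {x : R} (hx : x ∈ A) (y : R) : x * y ∈ A :=
    memA.2 fun i hi p => by rw [mul_smul, memA.1 hx i hi]
  have hB_mul {x : R} (hx : x ∈ B) (y : R) : x * y ∈ B :=
    memB.2 fun i hi p => by rw [mul_smul, memB.1 hx i hi]
  obtain ⟨a, ha, b, hb, hab⟩ := Submodule.mem_sup.1 (hAB ▸ Submodule.mem_top : (1 : R) ∈ A ⊔ B)
  have h1 (x : R) : a * x * b = 0 := hzero (hA_mul (hA_mul ha x) b) (B.smul_mem (a * x) hb)
  have h2 (x : R) : b * x * a = 0 := hzero (A.smul_mem (b * x) ha) (hB_mul (hB_mul hb x) a)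
  have hax (x : R) : a * x = a * x * a := by
    calc a * x = a * x * (a + b) := by rw [hab, mul_one]
      _ = a * x * a := by rw [mul_add, h1, add_zero]
  have hxa (x : R) : x * a = a * x * a := by
    calc x * a = (a + b) * x * a := by rw [hab, one_mul]
      _ = a * x * a := by rw [add_mul, add_mul, h2, add_zero]
  have hidem : IsIdempotentElem a := by
    have := hax 1
    rw [mul_one] at this
    exact this.symm
  have hcenter : a ∈ Set.center R :=
    Semigroup.mem_center_iff.2 fun x => (hxa x).trans (hax x).symm
  have hexists (i : ι) : ∃ p : P i, p ≠ 0 := by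
    by_contra! h
    exact hne i (eq_bot_iff.2 fun p _ => h p)
  rcases hR a hidem hcenter with h0 | h1
  · left
    rw [h0, zero_add] at hab
    refine Set.eq_empty_of_forall_notMem fun i hi => ?_
    obtain ⟨p, hp⟩ := hexists i
    exact hp (by rw [← one_smul R p, ← hab, memB.1 hb i hi])
  · right
    refine Set.eq_univ_of_forall fun i => by_contra fun hi => ?_
    obtain ⟨p, hp⟩ := hexists i
    exact hp (by rw [← one_smul R p, ← h1, memA.1 ha i hi])

end IsCoverSystem

end CoverSystems

section Extensions

variable {R : Type u} [Ring R] {ι : Type} {P : ι → ModuleCat.{u} R}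

namespace IsCoverSystem

theorem subsingleton_ext_iff [HasExt.{u} (ModuleCat.{u} R)] (hP : IsCoverSystem P)
    {M : Type u} [AddCommGroup M] [Module R M] {i : ι} (f : P i →ₗ[R] M) (hf : Function.Surjective f) (Y : ModuleCat.{u} R) (q : ℕ)
    (h : ∀ x : Abelian.Ext (P i) Y q,
      (Abelian.Ext.mk₀ (ModuleCat.ofHom (LinearMap.ker f).subtype)).comp x (zero_add q) = 0) :
    Subsingleton (Abelian.Ext (ModuleCat.of R M) Y (q + 1)) ↔
      Subsingleton (Abelian.Ext (ModuleCat.of R (LinearMap.ker f)) Y q) := by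
  have hS := LinearMap.shortExact_shortComplexKer hf
  have hproj : Projective (P i) := (IsProjective.iff_projective (P i)).1 (hP.projective i)
  constructor
  · intro hsub
    refine subsingleton_of_forall_eq 0 fun x => ?_
    obtain ⟨y, rfl⟩ := Abelian.Ext.contravariant_sequence_exact₁ hS Y x (add_comm 1 q)
      (hsub.elim _ _)
    exact h y
  · intro hsub
    refine subsingleton_of_forall_eq 0 fun x => ?_
    have hz : (Abelian.Ext.mk₀ (ModuleCat.ofHom f)).comp x (zero_add (q + 1)) = 0 :=
      Abelian.Ext.eq_zero_of_projective (P := P i) _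
    obtain ⟨y, rfl⟩ := Abelian.Ext.contravariant_sequence_exact₃ hS Y x hz (add_comm 1 q)
    have hy : y = 0 := hsub.elim _ _
    rw [hy, Abelian.Ext.comp_zero]

variable [IsArtinianRing R]

theorem exists_iterate_next_eq_self [Finite ι] (hP : IsCoverSystem P) (i : ι) :
    ∃ c, hP.next^[c] (hP.next i) = i := by
  obtain ⟨c, hc, hi⟩ := hP.next_injective.mem_periodicPts i
  obtain ⟨c, rfl⟩ := Nat.exists_eq_succ_of_ne_zero hc.ne'
  exact ⟨c, hi⟩

theorem loewyLength_eq [Finite ι] (hP : IsCoverSystem P)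
    (hne : ∀ i, (⊤ : Submodule R (P i)) ≠ ⊥)
    (hR : ∀ e : R, IsIdempotentElem e → e ∈ Set.center R → e = 0 ∨ e = 1) {i j : ι} {a : ℕ}
    (ha : HasLoewyLength (⊤ : Submodule R (P i)) a) :
    HasLoewyLength (⊤ : Submodule R (P j)) a := by
  have mono (c : ℕ) : ∀ {i : ι} {a b : ℕ}, HasLoewyLength (⊤ : Submodule R (P i)) a →
      HasLoewyLength (⊤ : Submodule R (P (hP.next^[c] i))) b → a ≤ b := by
    induction c with
    | zero => exact fun ha hb => (ha.eq hb).le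
    | succ c ih =>
      intro i a b ha hb
      have := hP.finite (hP.next i)
      obtain ⟨a', ha'⟩ := exists_hasLoewyLength (⊤ : Submodule R (P (hP.next i)))
      exact (hP.loewyLength_le_next ha ha').trans (ih ha' hb)
  have step (i : ι) : HasLoewyLength (⊤ : Submodule R (P (hP.next i))) a ↔
      HasLoewyLength (⊤ : Submodule R (P i)) a := by
    have := hP.finite i
    have := hP.finite (hP.next i)
    obtain ⟨b, hb⟩ := exists_hasLoewyLength (⊤ : Submodule R (P i))
    obtain ⟨b', hb'⟩ := exists_hasLoewyLength (⊤ : Submodule R (P (hP.next i)))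
    obtain ⟨c, hc⟩ := hP.exists_iterate_next_eq_self i
    obtain rfl : b = b' := le_antisymm (hP.loewyLength_le_next hb hb') (mono c hb' (hc.symm ▸ hb))
    exact ⟨fun h => h.eq hb' ▸ hb, fun h => h.eq hb ▸ hb'⟩
  rcases hP.eq_empty_or_univ hne hR {j | HasLoewyLength (⊤ : Submodule R (P j)) a} step with h | h
  · exact absurd (h ▸ ha : i ∈ (∅ : Set ι)) (Set.notMem_empty i)
  · exact (h ▸ Set.mem_univ j : j ∈ {j | HasLoewyLength (⊤ : Submodule R (P j)) a})

theorem exists_iterate_next_eq [Finite ι] (hP : IsCoverSystem P)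
    (hne : ∀ i, (⊤ : Submodule R (P i)) ≠ ⊥)
    (hR : ∀ e : R, IsIdempotentElem e → e ∈ Set.center R → e = 0 ∨ e = 1) (i j : ι) :
    ∃ c, hP.next^[c] i = j := by
  have step (j : ι) : hP.next j ∈ {j | ∃ c, hP.next^[c] i = j} ↔
      j ∈ {j | ∃ c, hP.next^[c] i = j} := by
    constructor
    · rintro ⟨c, hc⟩
      obtain ⟨d, hd⟩ := hP.exists_iterate_next_eq_self j
      exact ⟨d + c, by rw [Function.iterate_add_apply, hc, hd]⟩
    · rintro ⟨c, hc⟩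
      exact ⟨c + 1, by rw [Function.iterate_succ_apply', hc]⟩
  rcases hP.eq_empty_or_univ hne hR _ step with h | h
  · exact absurd (h ▸ ⟨0, rfl⟩ : i ∈ (∅ : Set ι)) (Set.notMem_empty i)
  · exact (h ▸ Set.mem_univ j : j ∈ {j | ∃ c, hP.next^[c] i = j})

/-- Two uniserial modules `K` and `Y` with `K` at least as long as `Y` admit a nonzero map
`K → Y` exactly when the top of `K` is a composition factor of `Y`. -/
theorem exists_hom_ne_zero_iff (hP : IsCoverSystem P) {K Y : Type u} [AddCommGroup K] [Module R K]
    [AddCommGroup Y] [Module R Y] {i s : ι} {b t : ℕ} (hK : Covers P i (⊤ : Submodule R K))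
    (hb : HasLoewyLength (⊤ : Submodule R K) b) (hY : Covers P s (⊤ : Submodule R Y))
    (ht : HasLoewyLength (⊤ : Submodule R Y) t) (htb : t ≤ b) :
    (∃ f : K →ₗ[R] Y, f ≠ 0) ↔ ∃ j < t, hP.next^[j] s = i := by
  constructor
  · rintro ⟨f, hf⟩
    obtain ⟨-, p, hp⟩ := id hY
    have := hP.finite s
    rw [LinearMap.range_eq_top] at hp
    have : Module.Finite R Y := Module.Finite.of_surjective p hp
    have hr : LinearMap.range f ≠ ⊥ := fun h => hf (LinearMap.range_eq_bot.1 h)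
    obtain ⟨j, hj⟩ := ((hP.uniserial s).of_surjective p hp).exists_eq_radLayer (LinearMap.range f)
    have hc : Covers P i (LinearMap.range f) := by
      have hmap : (⊤ : Submodule R K).map f = LinearMap.range f := Submodule.map_top f
      rw [← hmap] at hr ⊢
      exact hK.map f hr
    rw [hj] at hr hc
    refine ⟨j, ?_, hP.covers_unique (hP.covers_radLayer hY j hr) hc⟩
    rwa [Ne, ht, not_le] at hr
  · rintro ⟨j, hjt, rfl⟩
    have hr : radLayer (⊤ : Submodule R Y) j ≠ ⊥ := by rwa [Ne, ht, not_le]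
    obtain ⟨-, g, hg⟩ := hP.covers_radLayer hY j hr
    obtain ⟨-, p, hp⟩ := hK
    have := hP.finite (hP.next^[j] s)
    have hker : LinearMap.ker p ≤ LinearMap.ker g := by
      rw [(hP.uniserial _).ker_eq p (hp ▸ hb), (hP.uniserial _).ker_eq g (hg ▸ ht.radLayer j)]
      exact radLayer_antitone _ (by omega)
    rw [LinearMap.range_eq_top] at hp
    refine ⟨(LinearMap.ker p).liftQ g hker ∘ₗ (p.quotKerEquivOfSurjective hp).symm, fun h0 => ?_⟩
    apply hr
    rw [← hg, LinearMap.range_eq_bot]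
    ext x
    have hx : (p.quotKerEquivOfSurjective hp).symm (p x) = (LinearMap.ker p).mkQ x := by
      rw [LinearEquiv.symm_apply_eq]
      rfl
    have := LinearMap.congr_fun h0 (p x)
    simpa [hx] using this

theorem hasLoewyLength_ker (hP : IsCoverSystem P) {M : Type u} [AddCommGroup M] [Module R M]
    {m a : ℕ} {i : ι} (hm : HasLoewyLength (⊤ : Submodule R (P i)) m) (f : P i →ₗ[R] M)
    (ha : HasLoewyLength (LinearMap.range f) a) :
    HasLoewyLength (⊤ : Submodule R (LinearMap.ker f)) (m - a) := by
  have := hP.finite i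
  rw [HasLoewyLength.top_iff, (hP.uniserial i).ker_eq f ha]
  exact hm.radLayer a

theorem covers_ker (hP : IsCoverSystem P) {M : Type u} [AddCommGroup M] [Module R M]
    {m a : ℕ} {i : ι} (hm : HasLoewyLength (⊤ : Submodule R (P i)) m) (f : P i →ₗ[R] M)
    (ha : HasLoewyLength (LinearMap.range f) a) (ham : a < m) :
    Covers P (hP.next^[a] i) (⊤ : Submodule R (LinearMap.ker f)) := by
  have := hP.finite i
  rw [Covers.top_iff, (hP.uniserial i).ker_eq f ha]
  have hne (b : ℕ) (hb : b < m) : radLayer (⊤ : Submodule R (P i)) b ≠ ⊥ := by rwa [Ne, hm, not_le]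
  exact hP.covers_radLayer ⟨hne 0 (by omega), LinearMap.id, LinearMap.range_id⟩ a (hne a ham)

variable [HasExt.{u} (ModuleCat.{u} R)]

/-- The index shift of the projective cover under `q` syzygies, starting from length `a`. -/
def syzygyShift (m : ℕ) : ℕ → ℕ → ℕ
  | 0, _ => 0
  | q + 1, a => syzygyShift m q (m - a) + a

theorem not_subsingleton_ext_iff (hP : IsCoverSystem P) {m t : ℕ} {s : ι} {Y : ModuleCat.{u} R}
    (hm : ∀ i, HasLoewyLength (⊤ : Submodule R (P i)) m)
    (hY : Covers P s (⊤ : Submodule R Y)) (hYt : HasLoewyLength (⊤ : Submodule R Y) t)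
    (ht : 0 < t) (htm : 2 * t ≤ m) (q : ℕ) :
    ∀ (M : Type u) [AddCommGroup M] [Module R M] (i : ι) (a : ℕ),
      Covers P i (⊤ : Submodule R M) → HasLoewyLength (⊤ : Submodule R M) a → t ≤ a → a ≤ m - t →
      (¬ Subsingleton (Abelian.Ext (ModuleCat.of R M) Y (q + 1)) ↔
        ∃ j < t, hP.next^[j] s = hP.next^[syzygyShift m (q + 1) a] i) := by
  induction q with
  | zero =>
    intro M _ _ i a hM ha hta ham
    obtain ⟨-, f, hf⟩ := hM
    have := hP.finite i
    rw [← hf] at ha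
    have hKa := hP.hasLoewyLength_ker (hm i) f ha
    have hKc := hP.covers_ker (hm i) f ha (by omega)
    have hker := (hP.uniserial i).ker_eq f ha
    rw [LinearMap.range_eq_top] at hf
    rw [show syzygyShift m (0 + 1) a = a by simp [syzygyShift],
      hP.subsingleton_ext_iff f hf Y 0, Abelian.Ext.homEquiv₀.subsingleton_congr,
      not_subsingleton_iff_nontrivial, nontrivial_iff_exists_ne 0]
    · refine Iff.trans ⟨?_, ?_⟩ (hP.exists_hom_ne_zero_iff hKc hKa hY hYt (by omega))
      · rintro ⟨g, hg⟩
        exact ⟨g.hom, fun h => hg (ModuleCat.hom_ext h)⟩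
      · rintro ⟨g, hg⟩
        exact ⟨ModuleCat.ofHom g, fun h => hg (congrArg ModuleCat.Hom.hom h)⟩
    · intro x
      obtain ⟨g, rfl⟩ := Abelian.Ext.homEquiv₀.symm.surjective x
      have hg : ModuleCat.ofHom (LinearMap.ker f).subtype ≫ g = 0 := by
        have hle : LinearMap.ker f ≤ LinearMap.ker g.hom := by
          rw [hker, LinearMap.le_ker_iff_map, map_radLayer, eq_bot_iff,
            ← (hYt a).2 hta]
          exact radLayer_mono le_top a
        ext x
        exact hle x.2
      rw [Abelian.Ext.homEquiv₀_symm_apply, Abelian.Ext.mk₀_comp_mk₀, hg, Abelian.Ext.mk₀_zero]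
  | succ q ih =>
    intro M _ _ i a hM ha hta ham
    obtain ⟨-, f, hf⟩ := hM
    rw [← hf] at ha
    have hKa := hP.hasLoewyLength_ker (hm i) f ha
    have hKc := hP.covers_ker (hm i) f ha (by omega)
    rw [LinearMap.range_eq_top] at hf
    have hproj : Projective (P i) := (IsProjective.iff_projective (P i)).1 (hP.projective i)
    rw [hP.subsingleton_ext_iff f hf Y (q + 1), ih _ _ _ hKc hKa (by omega) (by omega),
      ← Function.iterate_add_apply,
      show syzygyShift m (q + 1 + 1) a = syzygyShift m (q + 1) (m - a) + a from rfl]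
    · intro x
      rw [x.eq_zero_of_projective, Abelian.Ext.comp_zero]

theorem syzygyShift_two_mul {m a : ℕ} (ha : a ≤ m) (r : ℕ) : syzygyShift m (2 * r) a = r * m := by
  induction r with
  | zero => simp [syzygyShift]
  | succ r ih =>
    rw [Nat.mul_succ, syzygyShift, syzygyShift, Nat.sub_sub_self ha, ih]
    have : (r + 1) * m = r * m + m := by ring
    omega

theorem syzygyShift_two_mul_add_one (m a r : ℕ) :
    syzygyShift m (2 * r + 1) a = r * m + a := by
  rw [syzygyShift, syzygyShift_two_mul (Nat.sub_le m a)]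

theorem not_subsingleton_ext_of_shorter [Finite ι] (hP : IsCoverSystem P)
    (hne : ∀ i, (⊤ : Submodule R (P i)) ≠ ⊥)
    (hR : ∀ e : R, IsIdempotentElem e → e ∈ Set.center R → e = 0 ∨ e = 1) {m t : ℕ}
    (hm : ∀ i, HasLoewyLength (⊤ : Submodule R (P i)) m) (ht : 1 < t) (htm : 2 * t ≤ m)
    {s s' : ι} {X X' : ModuleCat.{u} R}
    (hX : Covers P s (⊤ : Submodule R X)) (hXt : HasLoewyLength (⊤ : Submodule R X) t)
    (hX' : Covers P s' (⊤ : Submodule R X')) (hXt' : HasLoewyLength (⊤ : Submodule R X') (t - 1))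
    (q : ℕ) (h : ¬ Subsingleton (Abelian.Ext X' X' (q + 1))) :
    ¬ Subsingleton (Abelian.Ext X X (q + 1)) := by
  rw [hP.not_subsingleton_ext_iff hm hX' hXt' (by omega) (by omega) q X' s' (t - 1) hX' hXt'
    le_rfl (by omega)] at h
  rw [hP.not_subsingleton_ext_iff hm hX hXt (by omega) (by omega) q X s t hX hXt
    le_rfl (by omega)]
  obtain ⟨j, hj, h⟩ := h
  obtain ⟨c, rfl⟩ := hP.exists_iterate_next_eq hne hR s' s
  have hcomm (a b : ℕ) : hP.next^[a] (hP.next^[b] s') = hP.next^[b] (hP.next^[a] s') := by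
    rw [← Function.iterate_add_apply, ← Function.iterate_add_apply, add_comm]
  rcases Nat.even_or_odd' (q + 1) with ⟨r, hr | hr⟩
  · rw [hr, syzygyShift_two_mul (by omega)] at h ⊢
    exact ⟨j, by omega, by rw [hcomm, h, hcomm]⟩
  · rw [hr, syzygyShift_two_mul_add_one] at h ⊢
    refine ⟨j + 1, by omega, ?_⟩
    have hj' : hP.next^[j + 1] s' = hP.next^[r * m + t] s' := by
      rw [Function.iterate_succ_apply', h, ← Function.iterate_succ_apply' hP.next]
      congr 1
      omega
    rw [hcomm (j + 1) c, hj', hcomm _ c]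

end IsCoverSystem

end Extensions

section Nakayama

variable {R : Type u} [Ring R]

theorem radPow_eq_radLayer (a : ℕ) : radPow R a = radLayer (⊤ : Submodule R R) a := by
  induction a with
  | zero => rfl
  | succ a ih =>
    rw [radPow, radLayer, Ideal.jacobson_bot, ih]
    refine le_antisymm (Submodule.span_le.2 ?_) (Submodule.smul_le.2 fun r hr x hx => ?_)
    · rintro _ ⟨r, hr, x, hx, rfl⟩
      exact Submodule.smul_mem_smul hr hx
    · exact Submodule.subset_span ⟨r, hr, x, hx, rfl⟩

/-- In a uniserial module the composition length is the Loewy length. -/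
theorem Uniserial.hasLoewyLength [IsArtinianRing R] {X : ModuleCat.{u} R} [Module.Finite R X]
    (h : Uniserial R X) {t : ℕ} (ht : HasCompLength R X t) :
    HasLoewyLength (⊤ : Submodule R X) t := by
  obtain ⟨a, ha⟩ := exists_hasLoewyLength (⊤ : Submodule R X)
  obtain ⟨⟨c, hc, hc0, hct⟩, hmax⟩ := ht
  have hat : a ≤ t := by
    refine hmax a ⟨fun i => radLayer ⊤ (a - i), ?_, ?_, ?_⟩
    · refine Fin.strictMono_iff_lt_succ.2 fun i => ?_
      have hi : a - i.castSucc.val = (a - i.succ.val) + 1 := by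
        simp only [Fin.val_castSucc, Fin.val_succ]
        omega
      change radLayer ⊤ (a - i.castSucc.val) < radLayer ⊤ (a - i.succ.val)
      rw [hi]
      refine (radLayer_antitone _ (Nat.le_succ _)).lt_of_ne fun heq => ?_
      have hbot := eq_bot_of_le_smul heq.ge
      rw [ha, Fin.val_succ] at hbot
      omega
    · exact (ha _).2 (by simp)
    · simp [radLayer]
  have key (j : ℕ) (hj : j ≤ t) : c ⟨t - j, by omega⟩ ≤ radLayer ⊤ j := by
    induction j with
    | zero => exact le_top
    | succ j ih =>
      have hlt : c ⟨t - (j + 1), by omega⟩ < c ⟨t - j, by omega⟩ :=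
        hc (Fin.mk_lt_mk.2 (by omega))
      have hlt' := hlt.trans_le (ih (by omega))
      exact (h.le_smul_or_eq hlt'.le).resolve_right hlt'.ne
  have hbot : c ⟨t - a, by omega⟩ = c 0 := by
    rw [hc0, eq_bot_iff, ← (ha a).2 le_rfl]
    exact key a hat
  have := congrArg Fin.val (hc.injective hbot)
  simp only [Fin.val_zero] at this
  obtain rfl : a = t := by omega
  exact ha

/-- Over a self-injective artinian ring, each simple module is a quotient of an indecomposable
projective-injective module. -/
theorem exists_indec_projective_injective [IsArtinianRing R] (hR : Injective (ModuleCat.of R R))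
    (T : ModuleCat.{u} R) [IsSimpleModule R T] :
    ∃ Q : ModuleCat.{u} R, Indec R Q ∧ Module.Finite R Q ∧ Projective Q ∧ Injective Q ∧
      ∃ f : Q →ₗ[R] T, Function.Surjective f := by
  let C : Set (ModuleCat.{u} R) :=
    {Q | Nonempty (Retract Q (ModuleCat.of R R)) ∧ ∃ f : Q ⟶ T, f ≠ 0}
  have hT := IsSimpleModule.nontrivial R T
  have hC : C.Nonempty := by
    obtain ⟨x, hx⟩ := exists_ne (0 : T)
    refine ⟨ModuleCat.of R R, ⟨Retract.refl _⟩,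
      ModuleCat.ofHom (LinearMap.toSpanSingleton R T x), fun h => hx ?_⟩
    have := LinearMap.congr_fun (congrArg ModuleCat.Hom.hom h) (1 : R)
    simpa using this
  obtain ⟨Q, ⟨⟨e⟩, f, hf⟩, hmin⟩ :=
    (InvImage.wf (fun Q : ModuleCat.{u} R => Module.length R Q) wellFounded_lt).has_min C hC
  have hfin {Q' : ModuleCat.{u} R} (e : Retract Q' (ModuleCat.of R R)) : Module.Finite R Q' := by
    refine Module.Finite.of_surjective e.r.hom fun x => ⟨e.i.hom x, ?_⟩
    exact LinearMap.congr_fun (congrArg ModuleCat.Hom.hom e.retract) x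
  have hQfin := hfin e
  have hproj : Projective (ModuleCat.of R R) :=
    (IsProjective.iff_projective R).1 inferInstance
  have hzero {A B : ModuleCat.{u} R} (i : Q ≅ A ⊞ B) (g : A ⟶ T) (hg : g ≠ 0) : IsZero B := by
    have eA : Retract A Q :=
      { i := biprod.inl ≫ i.inv
        r := i.hom ≫ biprod.fst }
    have hA := hmin A ⟨⟨eA.trans e⟩, g, hg⟩
    have hlen : Module.length R Q = Module.length R A + Module.length R B := by
      rw [← Module.length_prod]
      exact (i ≪≫ ModuleCat.biprodIsoProd A B).toLinearEquiv.length_eq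
    have hle : Module.length R Q ≤ Module.length R A := not_lt.1 hA
    have hB : Module.length R B = 0 := by
      have hfinite : Module.length R A ≠ ⊤ := fun h =>
        Module.length_ne_top (R := R) (M := Q) (by rw [hlen, h, top_add])
      rw [hlen] at hle
      exact nonpos_iff_eq_zero.1 ((ENat.add_le_add_iff_left hfinite).1 (by simpa using hle))
    have := Module.length_eq_zero_iff.1 hB
    exact ModuleCat.isZero_of_subsingleton B
  refine ⟨Q, ⟨?_, ?_⟩, hQfin, e.projective, e.injective, f.hom, ?_⟩
  · exact fun hz => hf (hz.eq_of_src f 0)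
  · rintro A B ⟨i⟩
    by_cases hA : biprod.inl ≫ i.inv ≫ f = 0
    · by_cases hB : biprod.inr ≫ i.inv ≫ f = 0
      · refine absurd ?_ hf
        rw [← cancel_epi i.inv]
        apply biprod.hom_ext' <;> simp [hA, hB]
      · exact Or.inl (hzero (i ≪≫ biprod.braiding A B) _ hB)
    · exact Or.inr (hzero i _ hA)
  · exact LinearMap.surjective_of_ne_zero fun h => hf (ModuleCat.hom_ext h)

theorem Uniserial.nonempty_equiv_of_surjective {P T S : Type u} [AddCommGroup P] [Module R P]
    [AddCommGroup T] [Module R T] [AddCommGroup S] [Module R S] [IsSimpleModule R T]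
    [IsSimpleModule R S] (h : Uniserial R P) (f : P →ₗ[R] T) (g : P →ₗ[R] S)
    (hf : Function.Surjective f) (hg : Function.Surjective g) : Nonempty (T ≃ₗ[R] S) := by
  have hcf := LinearMap.isCoatom_ker_of_surjective hf
  have hcg := LinearMap.isCoatom_ker_of_surjective hg
  have hker : LinearMap.ker f = LinearMap.ker g := by
    rcases h (LinearMap.ker f) (LinearMap.ker g) with hle | hle
    · exact (hcf.le_iff_eq hcg.1).1 hle |>.symm
    · exact (hcg.le_iff_eq hcf.1).1 hle
  exact ⟨(f.quotKerEquivOfSurjective hf).symm ≪≫ₗ Submodule.quotEquivOfEq _ _ hker ≪≫ₗ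
    g.quotKerEquivOfSurjective hg⟩

/-- The common Loewy length of the modules in a cover system is that of the ring. -/
theorem IsCoverSystem.hasLoewyLength [IsArtinianRing R] {ι : Type} {P : ι → ModuleCat.{u} R}
    [Finite ι] (hP : IsCoverSystem P) (hne : ∀ i, (⊤ : Submodule R (P i)) ≠ ⊥)
    (hR : ∀ e : R, IsIdempotentElem e → e ∈ Set.center R → e = 0 ∨ e = 1) {m : ℕ}
    (htop : radPow R m = ⊥) (hbot : radPow R (m - 1) ≠ ⊥) (i : ι) :
    HasLoewyLength (⊤ : Submodule R (P i)) m := by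
  have := hP.finite
  obtain ⟨c, hc⟩ := exists_hasLoewyLength (⊤ : Submodule R (P i))
  rw [radPow_eq_radLayer] at htop hbot
  have hcm : c ≤ m := by
    rw [← hc m]
    have hJ : ∃ p : P i, p ∉ Ring.jacobson R • (⊤ : Submodule R (P i)) := by
      by_contra! h
      exact hne i (eq_bot_of_le_smul fun p _ => h p)
    obtain ⟨p, hp⟩ := hJ
    have hspan : Submodule.span R {p} = ⊤ :=
      ((hP.uniserial i).le_smul_top_or_eq_top (Submodule.span R {p})).resolve_left fun h =>
        hp (h (Submodule.mem_span_singleton_self p))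
    have := map_radLayer (LinearMap.toSpanSingleton R (P i) p) ⊤ m
    rwa [htop, Submodule.map_bot, Submodule.map_top, LinearMap.range_toSpanSingleton, hspan,
      eq_comm] at this
  have hmc : m ≤ c := by
    obtain ⟨x, hx, hx0⟩ := (Submodule.ne_bot_iff _).1 hbot
    obtain ⟨j, p, hp⟩ : ∃ j, ∃ p : P j, x • p ≠ 0 := by
      by_contra! h
      exact hx0 (hP.eq_zero_of_smul_eq_zero h)
    have hj : HasLoewyLength (⊤ : Submodule R (P j)) c := hP.loewyLength_eq hne hR hc
    by_contra! hlt
    apply hp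
    have hmem := Submodule.mem_map_of_mem (f := LinearMap.toSpanSingleton R (P j) p) hx
    rw [map_radLayer] at hmem
    have := radLayer_mono le_top (m - 1) hmem
    rw [(hj (m - 1)).2 (by omega)] at this
    simpa using this
  rwa [le_antisymm hcm hmc] at hc

theorem IsSelfInjNakayama.exists_isCoverSystem {k : Type u} [Field k] [Algebra k R] {n m : ℕ}
    (hR : IsSelfInjNakayama k R n m) :
    ∃ P : Fin n → ModuleCat.{u} R, IsCoverSystem P ∧ ∀ i, (⊤ : Submodule R (P i)) ≠ ⊥ := by
  have := hR.findim
  have : IsArtinianRing R := IsArtinianRing.of_finite k R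
  obtain ⟨S, hS, hinj, hall⟩ := hR.simples
  choose P hind hfin hproj hinjP f hf using
    fun i => exists_indec_projective_injective hR.selfinj (S i)
  have huni (i : Fin n) : Uniserial R (P i) := hR.uniserial (P i) (hfin i) (hind i)
  refine ⟨P, ⟨hfin, fun i => (IsProjective.iff_projective (P i)).2 (hproj i),
    fun i => (Module.injective_iff_injective_object R (P i)).2 (hinjP i), huni, ?_, ?_⟩, ?_⟩
  · intro T _ _ hT
    obtain ⟨i, ⟨e⟩⟩ := hall (ModuleCat.of R T) hT
    exact ⟨i, e.symm.toLinearEquiv.toLinearMap ∘ₗ f i,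
      e.symm.toLinearEquiv.surjective.comp (hf i)⟩
  · intro T _ _ _ i j p q hp hq
    obtain ⟨e⟩ := (huni i).nonempty_equiv_of_surjective (f i) p (hf i) hp
    obtain ⟨e'⟩ := (huni j).nonempty_equiv_of_surjective q (f j) hq (hf j)
    exact hinj i j ⟨(e.trans e').toModuleIso⟩
  · intro i h
    have : Subsingleton (P i) := (Submodule.subsingleton_iff R).1 (subsingleton_of_bot_eq_top h.symm)
    exact (hind i).1 (ModuleCat.isZero_of_subsingleton _)

theorem rigDeg_le_rigDeg [HasExt.{u} (ModuleCat.{u} R)] {X X' : ModuleCat.{u} R}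
    (h : ∀ i : ℕ, 0 < i → ¬ Subsingleton (Abelian.Ext X' X' i) →
      ¬ Subsingleton (Abelian.Ext X X i)) : rigDeg R X ≤ rigDeg R X' := by
  refine sSup_le_sSup ?_
  rintro _ ⟨r, rfl, hr, hX⟩
  exact ⟨r, rfl, hr, fun i hi hir => not_not.1 fun hX' => h i hi hX' (hX i hi hir)⟩

end Nakayama

/-- Lemma `lem-inSE`(3): for `Λ = A_{n,m}` and `1 < t ≤ m/2`, with `X_t`
and `X_{t-1}` indecomposables of lengths `t` and `t-1`, one has `SE(t-1) ⊆ SE(t)`;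
in particular the rigidity degree satisfies `rd(t) ≤ rd(t-1)`. -/
theorem statement6 (k : Type u) [Field k] (Λ : Type u) [Ring Λ] [Algebra k Λ]
    (n m : ℕ) (hn : 0 < n) (hnm : n ≤ m)
    (hΛ : IsSelfInjNakayama k Λ n m)
    [HasExt.{u} (ModuleCat.{u} Λ)]
    (t : ℕ) (ht : 1 < t) (ht2 : 2 * t ≤ m)
    (X X' : ModuleCat.{u} Λ)
    (hXfin : Module.Finite Λ X) (hXind : Indec Λ X) (hXlen : HasCompLength Λ X t)
    (hX'fin : Module.Finite Λ X') (hX'ind : Indec Λ X') (hX'len : HasCompLength Λ X' (t - 1)) :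
    (∀ i : ℕ, 0 < i → ¬ Subsingleton (Abelian.Ext X' X' i) →
      ¬ Subsingleton (Abelian.Ext X X i)) ∧
    rigDeg Λ X ≤ rigDeg Λ X' := by
  have hfd := hΛ.findim
  have : IsArtinianRing Λ := IsArtinianRing.of_finite k Λ
  obtain ⟨P, hP, hne⟩ := hΛ.exists_isCoverSystem
  have hm := hP.hasLoewyLength hne hΛ.connected hΛ.loewy_top hΛ.loewy_bot
  have hX : Uniserial Λ X := hΛ.uniserial X hXfin hXind
  have hX' : Uniserial Λ X' := hΛ.uniserial X' hX'fin hX'ind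
  have hXt := hX.hasLoewyLength hXlen
  have hX't := hX'.hasLoewyLength hX'len
  have hX0 : (⊤ : Submodule Λ X) ≠ ⊥ := fun h => by
    have := (hXt 0).1 h
    omega
  have hX'0 : (⊤ : Submodule Λ X') ≠ ⊥ := fun h => by
    have := (hX't 0).1 h
    omega
  obtain ⟨s, hs⟩ := hP.exists_covers_top hX hX0
  obtain ⟨s', hs'⟩ := hP.exists_covers_top hX' hX'0
  have hSE (i : ℕ) (hi : 0 < i) (h : ¬ Subsingleton (Abelian.Ext X' X' i)) :
      ¬ Subsingleton (Abelian.Ext X X i) := by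
    obtain ⟨q, rfl⟩ := Nat.exists_eq_succ_of_ne_zero hi.ne'
    exact hP.not_subsingleton_ext_of_shorter hne hΛ.connected hm ht ht2 hs hXt hs' hX't q h
  exact ⟨hSE, rigDeg_le_rigDeg hSE⟩

end Rigidity
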